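/- arXiv:cond-mat/0509649 — 5 statements merged into one kernel-verified Lean document; each statement's English description precedes it below -/
import Mathlib

section
/- Let (X, Σ, μ) be a σ-finite measure space, let P : L¹(μ) → L¹(μ) be a Markov operator, and let f_* be a stationary density of P (P f_* = f_*) with f_* > 0 a.e. Then for every density f the conditional entropy does not decrease under P: H_c(P f | f_*) ≥ H_c(f | f_*), where both sides take values in [−∞, 0]. -/
open MeasureTheory Real Filter
open scoped ENNReal

/-- The conditional entropy `H_c(f | g) = -∫ f log (f/g) dμ`, valued in `[-∞, 0]`.
Since `∫ f = ∫ g = 1`, the integrand `f log(f/g) + g - f` is a.e. nonnegative and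
`H_c(f|g)` is minus its lower integral. -/
noncomputable def condEnt {X : Type*} [MeasurableSpace X] (μ : Measure X)
    (f g : X → ℝ) : EReal :=
  - ((∫⁻ x, ENNReal.ofReal (f x * Real.log (f x / g x) + g x - f x) ∂μ : ℝ≥0∞) : EReal)

lemma aux_upper (a u g : ℝ) (hu : 0 ≤ u) (hg : 0 < g) :
    a * u + (1 - Real.exp a) * g ≤ u * Real.log (u / g) + g - u := by
  rcases hu.eq_or_lt with rfl | hu
  · simp
    have := mul_pos (Real.exp_pos a) hg
    nlinarith
  · have h1 := Real.add_one_le_exp (a - Real.log (u / g))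
    rw [Real.exp_sub, Real.exp_log (by positivity)] at h1
    have h2 : u * (Real.exp a / (u / g)) = Real.exp a * g := by field_simp
    have h3 := mul_le_mul_of_nonneg_left h1 hu.le
    rw [h2] at h3
    nlinarith

lemma aux_lower (u g : ℝ) (hu : 0 ≤ u) (hg : 0 < g) (a : ℕ → ℝ) (ha : DenseRange a)
    (S : ℝ≥0∞) (hS : ∀ n, ENNReal.ofReal (a n * u + (1 - Real.exp (a n)) * g) ≤ S) :
    ENNReal.ofReal (u * Real.log (u / g) + g - u) ≤ S := by
  have hcont : Continuous fun t : ℝ => ENNReal.ofReal (t * u + (1 - Real.exp t) * g) :=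
    ENNReal.continuous_ofReal.comp (by fun_prop)
  have hall : ∀ t : ℝ, ENNReal.ofReal (t * u + (1 - Real.exp t) * g) ≤ S := fun t =>
    ha.induction_on (p := fun t : ℝ => ENNReal.ofReal (t * u + (1 - Real.exp t) * g) ≤ S) t
      (isClosed_le hcont continuous_const) hS
  rcases hu.eq_or_lt with rfl | hu
  · have ht : Tendsto (fun t : ℝ => ENNReal.ofReal (t * 0 + (1 - Real.exp t) * g)) atBot
        (nhds (ENNReal.ofReal (0 * Real.log (0 / g) + g - 0))) := by
      apply ENNReal.tendsto_ofReal
      have := (Real.tendsto_exp_atBot.const_sub 1).mul_const g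
      simpa using this
    exact le_of_tendsto' ht hall
  · have := hall (Real.log (u / g))
    rw [Real.exp_log (by positivity)] at this
    convert this using 2
    field_simp
    ring

/-- Finite maxima of the tangent-line functionals. -/
noncomputable def tangentMax {X : Type*} [MeasurableSpace X] {μ : Measure X}
    (a : ℕ → ℝ) (f g : Lp ℝ 1 μ) : ℕ → Lp ℝ 1 μ
  | 0 => 0
  | n + 1 => tangentMax a f g n ⊔ (a n • f + (1 - Real.exp (a n)) • g)

lemma coeFn_tangent {X : Type*} [MeasurableSpace X] {μ : Measure X}
    (s t : ℝ) (f g : Lp ℝ 1 μ) :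
    ∀ᵐ x ∂μ, (s • f + t • g : Lp ℝ 1 μ) x = s * f x + t * g x := by
  filter_upwards [Lp.coeFn_add (s • f) (t • g), Lp.coeFn_smul s f, Lp.coeFn_smul t g]
    with x h1 h2 h3
  rw [h1, Pi.add_apply, h2, h3]
  rfl

lemma tangentMax_upper {X : Type*} [MeasurableSpace X] {μ : Measure X}
    (a : ℕ → ℝ) (f g : Lp ℝ 1 μ) (hf : 0 ≤ f) (hg : ∀ᵐ x ∂μ, 0 < g x) (n : ℕ) :
    ∀ᵐ x ∂μ, tangentMax a f g n x ≤ f x * Real.log (f x / g x) + g x - f x := by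
  have hf' := (Lp.coeFn_nonneg f).2 hf
  induction n with
  | zero =>
    filter_upwards [Lp.coeFn_zero ℝ 1 μ, hf', hg] with x h0 h1 h2
    have := aux_upper 0 (f x) (g x) h1 h2
    simp only [tangentMax, h0]
    simpa using this
  | succ n ih =>
    filter_upwards [ih, hf', hg, coeFn_tangent (a n) (1 - Real.exp (a n)) f g,
      Lp.coeFn_sup (tangentMax a f g n) (a n • f + (1 - Real.exp (a n)) • g)]
      with x h0 h1 h2 h3 h4
    simp only [tangentMax, h4, Pi.sup_apply, h3]
    exact sup_le h0 (aux_upper _ _ _ h1 h2)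

/-- Voigt's theorem: the conditional entropy does not decrease under a Markov operator
with stationary density `fstar`. -/
theorem condEnt_nondecreasing_of_markov
    {X : Type*} [MeasurableSpace X] {μ : Measure X} [SigmaFinite μ]
    (P : Lp ℝ 1 μ →ₗ[ℝ] Lp ℝ 1 μ)
    (hP_pos : ∀ f : Lp ℝ 1 μ, 0 ≤ f → 0 ≤ P f)
    (hP_int : ∀ f : Lp ℝ 1 μ, 0 ≤ f → ∫ x, (P f : X → ℝ) x ∂μ = ∫ x, (f : X → ℝ) x ∂μ)
    (fstar : Lp ℝ 1 μ)
    (hfs_pos : ∀ᵐ x ∂μ, 0 < (fstar : X → ℝ) x)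
    (hfs_one : ∫ x, (fstar : X → ℝ) x ∂μ = 1)
    (hstat : P fstar = fstar)
    (f : Lp ℝ 1 μ) (hf_pos : 0 ≤ f) (hf_one : ∫ x, (f : X → ℝ) x ∂μ = 1) :
    condEnt μ (f : X → ℝ) (fstar : X → ℝ) ≤ condEnt μ (P f : X → ℝ) (fstar : X → ℝ) := by
  obtain ⟨a, ha⟩ := TopologicalSpace.exists_dense_seq ℝ
  have hmono : ∀ u v : Lp ℝ 1 μ, u ≤ v → P u ≤ P v := fun u v h => by
    have := hP_pos (v - u) (sub_nonneg.2 h)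
    rw [map_sub] at this
    exact sub_nonneg.1 this
  have hF0 : ∀ (u : Lp ℝ 1 μ) n, 0 ≤ tangentMax a u fstar n := fun u n => by
    induction n with
    | zero => exact le_rfl
    | succ n ih => exact ih.trans le_sup_left
  have hGF : ∀ n, tangentMax a (P f) fstar n ≤ P (tangentMax a f fstar n) := fun n => by
    induction n with
    | zero => simp [tangentMax]
    | succ n ih =>
      refine sup_le (ih.trans (hmono _ _ le_sup_left)) ?_
      have h := hmono (a n • f + (1 - Real.exp (a n)) • fstar) (tangentMax a f fstar (n + 1))
        le_sup_right
      rwa [map_add, map_smul, map_smul, hstat] at h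
  have hlint : ∀ u : Lp ℝ 1 μ, 0 ≤ u →
      ∫⁻ x, ENNReal.ofReal (u x) ∂μ = ENNReal.ofReal (∫ x, u x ∂μ) := fun u hu =>
    (ofReal_integral_eq_lintegral_ofReal (L1.integrable_coeFn u)
      ((Lp.coeFn_nonneg u).2 hu)).symm
  have hbound : ∀ n, ∫⁻ x, ENNReal.ofReal (tangentMax a (P f) fstar n x) ∂μ ≤
      ∫⁻ x, ENNReal.ofReal (f x * Real.log (f x / fstar x) + fstar x - f x) ∂μ := fun n => by
    calc _ ≤ ∫⁻ x, ENNReal.ofReal (P (tangentMax a f fstar n) x) ∂μ := by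
          apply lintegral_mono_ae
          filter_upwards [(Lp.coeFn_le _ _).2 (hGF n)] with x hx
          exact ENNReal.ofReal_le_ofReal hx
      _ = ∫⁻ x, ENNReal.ofReal (tangentMax a f fstar n x) ∂μ := by
          rw [hlint _ (hP_pos _ (hF0 f n)), hlint _ (hF0 f n), hP_int _ (hF0 f n)]
      _ ≤ _ := by
          apply lintegral_mono_ae
          filter_upwards [tangentMax_upper a f fstar hf_pos hfs_pos n] with x hx
          exact ENNReal.ofReal_le_ofReal hx
  have hstep : ∀ᵐ x ∂μ, ∀ n, tangentMax a (P f) fstar n x ≤ tangentMax a (P f) fstar (n+1) x :=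
    ae_all_iff.2 fun n => (Lp.coeFn_le _ _).2 le_sup_left
  have htan : ∀ᵐ x ∂μ, ∀ n, a n * (P f) x + (1 - Real.exp (a n)) * fstar x
      ≤ tangentMax a (P f) fstar (n+1) x := by
    refine ae_all_iff.2 fun n => ?_
    have h : a n • (P f) + (1 - Real.exp (a n)) • fstar ≤ tangentMax a (P f) fstar (n+1) :=
      le_sup_right
    filter_upwards [(Lp.coeFn_le _ _).2 h,
      coeFn_tangent (a n) (1 - Real.exp (a n)) (P f) fstar] with x h1 h2
    rwa [h2] at h1
  unfold condEnt
  rw [EReal.neg_le_neg_iff, EReal.coe_ennreal_le_coe_ennreal_iff]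
  calc _ ≤ ∫⁻ x, ⨆ n, ENNReal.ofReal (tangentMax a (P f) fstar n x) ∂μ := by
        apply lintegral_mono_ae
        filter_upwards [htan, hfs_pos, (Lp.coeFn_nonneg _).2 (hP_pos f hf_pos)] with x h1 h2 h3
        refine aux_lower _ _ h3 h2 a ha _ fun n => ?_
        exact (ENNReal.ofReal_le_ofReal (h1 n)).trans
          (le_iSup (fun n => ENNReal.ofReal (tangentMax a (P f) fstar n x)) (n + 1))
    _ = ⨆ n, ∫⁻ x, ENNReal.ofReal (tangentMax a (P f) fstar n x) ∂μ := by
        apply lintegral_iSup'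
        · exact fun n => (Lp.aestronglyMeasurable _).aemeasurable.ennreal_ofReal
        · filter_upwards [hstep] with x hx
          exact monotone_nat_of_le_succ fun n => ENNReal.ofReal_le_ofReal (hx n)
    _ ≤ _ := iSup_le hbound
end

section
/- Let (X, Σ, μ) be a σ-finite measure space and let P : L¹(μ) → L¹(μ) be an invertible Markov operator, i.e. P is bijective and its inverse P⁻¹ is also a Markov operator. Suppose P has a stationary density f_* (P f_* = f_*) with f_* > 0 a.e. Then the conditional entropy is conserved: for every density f, H_c(P f | f_*) = H_c(f | f_*). -/
open MeasureTheory Real Filter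
open scoped ENNReal

lemma aux_ub (a b s : ℝ) (ha : 0 ≤ a) (hb : 0 < b) (hs : 0 < s) :
    Real.log s * a + (1 - s) * b ≤ a * Real.log (a / b) + b - a := by
  rcases ha.eq_or_lt with rfl | ha
  · simp; nlinarith [mul_pos hs hb]
  · have h := Real.log_le_sub_one_of_pos (show 0 < s * b / a by positivity)
    rw [Real.log_div (by positivity) ha.ne', Real.log_mul hs.ne' hb.ne'] at h
    rw [Real.log_div ha.ne' hb.ne']
    have h2 := mul_le_mul_of_nonneg_left h ha.le
    have h3 : a * (s * b / a - 1) = s * b - a := by field_simp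
    rw [h3] at h2
    nlinarith

lemma aux_lb (a b c : ℝ) (ha : 0 ≤ a) (hb : 0 < b)
    (hc : c < a * Real.log (a / b) + b - a) :
    ∃ s : Set.Ioi (0 : ℝ), c < Real.log s * a + (1 - s) * b := by
  rcases ha.eq_or_lt with rfl | ha
  · simp at hc
    have hs : 0 < (b - c) / (2 * b) := div_pos (sub_pos.2 hc) (by positivity)
    refine ⟨⟨(b - c) / (2 * b), hs⟩, ?_⟩
    have : (1 - (b - c) / (2 * b)) * b = b - (b - c) / 2 := by field_simp
    simp only [mul_zero, zero_add, this]
    linarith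
  · refine ⟨⟨a / b, div_pos ha hb⟩, ?_⟩
    have : (1 - a / b) * b = b - a := by field_simp
    simp only [this]
    linarith

lemma aux_dense (a b c : ℝ) (ha : 0 ≤ a) (hb : 0 < b)
    (hc : c < a * Real.log (a / b) + b - a) :
    ∃ n : ℕ, c < Real.log (TopologicalSpace.denseSeq (Set.Ioi (0 : ℝ)) n : ℝ) * a
      + (1 - (TopologicalSpace.denseSeq (Set.Ioi (0 : ℝ)) n : ℝ)) * b := by
  have hcont : Continuous (fun s : Set.Ioi (0 : ℝ) => Real.log s * a + (1 - (s : ℝ)) * b) := by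
    have : Continuous (fun s : Set.Ioi (0 : ℝ) => Real.log s) :=
      continuous_subtype_val.log (fun s => (ne_of_gt s.2))
    fun_prop
  have ho : IsOpen {s : Set.Ioi (0 : ℝ) | c < Real.log s * a + (1 - (s : ℝ)) * b} :=
    isOpen_lt continuous_const hcont
  obtain ⟨s, hs⟩ := aux_lb a b c ha hb hc
  obtain ⟨y, hy, n, rfl⟩ :=
    (TopologicalSpace.denseRange_denseSeq (Set.Ioi (0 : ℝ))).inter_open_nonempty _ ho ⟨s, hs⟩
  exact ⟨n, hy⟩

noncomputable def auxA {X : Type*} [MeasurableSpace X] {μ : Measure X}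
    (f g : Lp ℝ 1 μ) (n : ℕ) : Lp ℝ 1 μ :=
  Real.log (TopologicalSpace.denseSeq (Set.Ioi (0 : ℝ)) n : ℝ) • f
      + (1 - (TopologicalSpace.denseSeq (Set.Ioi (0 : ℝ)) n : ℝ)) • g

noncomputable def auxH {X : Type*} [MeasurableSpace X] {μ : Measure X}
    (f g : Lp ℝ 1 μ) : ℕ → Lp ℝ 1 μ
  | 0 => 0
  | n + 1 => auxH f g n ⊔ auxA f g n

lemma auxA_coe {X : Type*} [MeasurableSpace X] {μ : Measure X} (f g : Lp ℝ 1 μ) (n : ℕ) :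
    ∀ᵐ x ∂μ, (auxA f g n : X → ℝ) x =
      Real.log (TopologicalSpace.denseSeq (Set.Ioi (0 : ℝ)) n : ℝ) * (f : X → ℝ) x
      + (1 - (TopologicalSpace.denseSeq (Set.Ioi (0 : ℝ)) n : ℝ)) * (g : X → ℝ) x := by
  unfold auxA
  filter_upwards [Lp.coeFn_add (Real.log (TopologicalSpace.denseSeq (Set.Ioi (0 : ℝ)) n : ℝ) • f)
      ((1 - (TopologicalSpace.denseSeq (Set.Ioi (0 : ℝ)) n : ℝ)) • g),
    Lp.coeFn_smul (Real.log (TopologicalSpace.denseSeq (Set.Ioi (0 : ℝ)) n : ℝ)) f,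
    Lp.coeFn_smul (1 - (TopologicalSpace.denseSeq (Set.Ioi (0 : ℝ)) n : ℝ)) g] with x h1 h2 h3
  rw [h1, Pi.add_apply, h2, h3]
  simp

lemma auxH_mono {X : Type*} [MeasurableSpace X] {μ : Measure X} (f g : Lp ℝ 1 μ) :
    Monotone (auxH f g) :=
  monotone_nat_of_le_succ fun _ => le_sup_left

lemma auxH_le {X : Type*} [MeasurableSpace X] {μ : Measure X} (f g : Lp ℝ 1 μ)
    (hf : 0 ≤ f) (hg : ∀ᵐ x ∂μ, 0 < (g : X → ℝ) x) (n : ℕ) :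
    ∀ᵐ x ∂μ, (auxH f g n : X → ℝ) x ≤
      f x * Real.log (f x / g x) + g x - f x := by
  have hf' := (Lp.coeFn_nonneg f).2 hf
  induction n with
  | zero =>
    filter_upwards [hf', hg, Lp.coeFn_zero ℝ 1 μ] with x h1 h2 h3
    have := aux_ub (f x) (g x) 1 h1 h2 one_pos
    simp only [auxH]
    rw [h3]
    simpa using this
  | succ n ih =>
    filter_upwards [hf', hg, ih, Lp.coeFn_sup (auxH f g n) (auxA f g n), auxA_coe f g n]
      with x h1 h2 h3 h4 h5
    simp only [auxH]
    rw [h4, Pi.sup_apply]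
    refine sup_le h3 ?_
    rw [h5]
    exact aux_ub _ _ _ h1 h2 (TopologicalSpace.denseSeq (Set.Ioi (0 : ℝ)) n).2

lemma auxH_map {X : Type*} [MeasurableSpace X] {μ : Measure X}
    (P : Lp ℝ 1 μ →ₗ[ℝ] Lp ℝ 1 μ) (hP_pos : ∀ f : Lp ℝ 1 μ, 0 ≤ f → 0 ≤ P f)
    (f g : Lp ℝ 1 μ) (hg : P g = g) (n : ℕ) :
    auxH (P f) g n ≤ P (auxH f g n) := by
  have hmono : ∀ u v : Lp ℝ 1 μ, u ≤ v → P u ≤ P v := by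
    intro u v huv
    have := hP_pos (v - u) (sub_nonneg.2 huv)
    rw [map_sub] at this
    exact sub_nonneg.1 this
  induction n with
  | zero => simp [auxH]
  | succ n ih =>
    simp only [auxH]
    refine sup_le (ih.trans (hmono _ _ le_sup_left)) ?_
    have : auxA (P f) g n = P (auxA f g n) := by simp [auxA, hg]
    rw [this]
    exact hmono _ _ le_sup_right

lemma aux_main {X : Type*} [MeasurableSpace X] {μ : Measure X}
    (P : Lp ℝ 1 μ →ₗ[ℝ] Lp ℝ 1 μ) (hP_pos : ∀ f : Lp ℝ 1 μ, 0 ≤ f → 0 ≤ P f)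
    (hP_int : ∀ f : Lp ℝ 1 μ, 0 ≤ f → ∫ x, (P f : X → ℝ) x ∂μ = ∫ x, (f : X → ℝ) x ∂μ)
    (f g : Lp ℝ 1 μ) (hf : 0 ≤ f) (hgp : ∀ᵐ x ∂μ, 0 < (g : X → ℝ) x) (hg : P g = g) :
    ∫⁻ x, ENNReal.ofReal ((P f : X → ℝ) x * Real.log ((P f : X → ℝ) x / g x) + g x
      - (P f : X → ℝ) x) ∂μ ≤
    ∫⁻ x, ENNReal.ofReal (f x * Real.log (f x / g x) + g x - f x) ∂μ := by
  have hPf := (Lp.coeFn_nonneg _).2 (hP_pos f hf)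
  have hint : ∀ u : Lp ℝ 1 μ, 0 ≤ u →
      ∫⁻ x, ENNReal.ofReal ((u : X → ℝ) x) ∂μ = ENNReal.ofReal (∫ x, (u : X → ℝ) x ∂μ) := by
    intro u hu
    rw [ofReal_integral_eq_lintegral_ofReal (L1.integrable_coeFn u) ((Lp.coeFn_nonneg _).2 hu)]
  calc _ ≤ ∫⁻ x, ⨆ n, ENNReal.ofReal ((auxH (P f) g n : X → ℝ) x) ∂μ := by
        apply lintegral_mono_ae
        have hA := ae_all_iff.2 (auxA_coe (P f) g)
        have hS := ae_all_iff.2 (fun n => (Lp.coeFn_le (auxA (P f) g n) (auxH (P f) g (n+1))).2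
          (by simp only [auxH]; exact le_sup_right))
        filter_upwards [hPf, hgp, hA, hS] with x h1 h2 h3 h4
        refine le_of_forall_lt fun c hc => ?_
        obtain ⟨n, hn⟩ := aux_dense _ _ c.toReal h1 h2
          (by rw [ENNReal.lt_ofReal_iff_toReal_lt hc.ne_top] at hc; exact hc)
        refine lt_of_lt_of_le ?_ (le_iSup _ (n+1))
        rw [ENNReal.lt_ofReal_iff_toReal_lt hc.ne_top]
        rw [← h3 n] at hn
        exact hn.trans_le (h4 n)
    _ = ⨆ n, ∫⁻ x, ENNReal.ofReal ((auxH (P f) g n : X → ℝ) x) ∂μ := by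
        apply lintegral_iSup'
        · intro n
          exact (Lp.aestronglyMeasurable _).aemeasurable.ennreal_ofReal
        · have := ae_all_iff.2 (fun n => (Lp.coeFn_le _ _).2
            (auxH_mono (P f) g (Nat.le_succ n)))
          filter_upwards [this] with x hx
          exact monotone_nat_of_le_succ fun n => ENNReal.ofReal_le_ofReal (hx n)
    _ ≤ _ := by
        refine iSup_le fun n => ?_
        have h0 : 0 ≤ auxH f g n := auxH_mono f g (Nat.zero_le n)
        calc _ ≤ ∫⁻ x, ENNReal.ofReal ((P (auxH f g n) : X → ℝ) x) ∂μ := by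
              apply lintegral_mono_ae
              filter_upwards [(Lp.coeFn_le _ _).2 (auxH_map P hP_pos f g hg n)] with x hx
              exact ENNReal.ofReal_le_ofReal hx
          _ = ∫⁻ x, ENNReal.ofReal ((auxH f g n : X → ℝ) x) ∂μ := by
              rw [hint _ (hP_pos _ h0), hint _ h0, hP_int _ h0]
          _ ≤ _ := by
              apply lintegral_mono_ae
              filter_upwards [auxH_le f g hf hgp n] with x hx
              exact ENNReal.ofReal_le_ofReal hx

/-- For an invertible Markov operator (a bijective Markov operator whose inverse is also a
Markov operator) with stationary density `fstar`, the conditional entropy is conserved. -/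
theorem condEnt_eq_of_invertible_markov
    {X : Type*} [MeasurableSpace X] {μ : Measure X} [SigmaFinite μ]
    (P : Lp ℝ 1 μ ≃ₗ[ℝ] Lp ℝ 1 μ)
    (hP_pos : ∀ f : Lp ℝ 1 μ, 0 ≤ f → 0 ≤ P f)
    (hP_int : ∀ f : Lp ℝ 1 μ, 0 ≤ f → ∫ x, (P f : X → ℝ) x ∂μ = ∫ x, (f : X → ℝ) x ∂μ)
    (hPinv_pos : ∀ f : Lp ℝ 1 μ, 0 ≤ f → 0 ≤ P.symm f)
    (hPinv_int : ∀ f : Lp ℝ 1 μ, 0 ≤ f →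
      ∫ x, (P.symm f : X → ℝ) x ∂μ = ∫ x, (f : X → ℝ) x ∂μ)
    (fstar : Lp ℝ 1 μ)
    (hfs_pos : ∀ᵐ x ∂μ, 0 < (fstar : X → ℝ) x)
    (hfs_one : ∫ x, (fstar : X → ℝ) x ∂μ = 1)
    (hstat : P fstar = fstar)
    (f : Lp ℝ 1 μ) (hf_pos : 0 ≤ f) (hf_one : ∫ x, (f : X → ℝ) x ∂μ = 1) :
    condEnt μ (P f : X → ℝ) (fstar : X → ℝ) = condEnt μ (f : X → ℝ) (fstar : X → ℝ) := by
  unfold condEnt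
  congr 2
  apply le_antisymm
  · exact aux_main P.toLinearMap hP_pos hP_int f fstar hf_pos hfs_pos hstat
  · have h := aux_main P.symm.toLinearMap hPinv_pos hPinv_int (P f) fstar (hP_pos f hf_pos)
      hfs_pos (by
        simp only [LinearEquiv.coe_coe]
        rw [LinearEquiv.symm_apply_eq, hstat])
    simpa only [LinearEquiv.coe_coe, LinearEquiv.symm_apply_apply] using h
end

section
/- Let (X, Σ, μ) be a σ-finite measure space and {P^t}_{t≥0} a semigroup of Markov operators on L¹(μ) (P⁰ = Id, P^{t+s} = P^t ∘ P^s) with a stationary density f_* (P^t f_* = f_* for all t ≥ 0), f_* > 0 a.e. If {P^t} is asymptotically stable, i.e. ‖P^t f₀ − f_*‖_{L¹} → 0 as t → ∞ for every density f₀, then for every density f₀ with H_c(f₀ | f_*) > −∞ one has lim_{t→∞} H_c(P^t f₀ | f_*) = 0. -/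
open MeasureTheory Real Filter
open scoped ENNReal

namespace EntAux

noncomputable def psi (M u : ℝ) : ℝ := max u M * Real.log (max u M / M) - max u M + M

lemma psi_of_le {M u : ℝ} (hM : 1 ≤ M) (h : u ≤ M) : psi M u = 0 := by
  have : M / M = 1 := div_self (by linarith)
  simp [psi, max_eq_right h, this]

lemma psi_of_ge {M u : ℝ} (h : M ≤ u) : psi M u = u * Real.log (u / M) - u + M := by
  simp [psi, max_eq_left h]

lemma psi_eq {M u : ℝ} (hM : 1 ≤ M) :
    ∃ q : ℝ, psi M u = |q| * u + M * (1 - Real.exp |q|) := by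
  rcases le_total u M with h | h
  · exact ⟨0, by simp [psi_of_le hM h]⟩
  · refine ⟨Real.log (u / M), ?_⟩
    have h1 : 1 ≤ u / M := by rw [le_div_iff₀ (by linarith)]; linarith
    rw [abs_of_nonneg (Real.log_nonneg h1), Real.exp_log (by linarith), psi_of_ge h]
    have : M ≠ 0 := by linarith
    field_simp
    ring

lemma le_psi {M u : ℝ} (hM : 1 ≤ M) (q : ℝ) :
    |q| * u + M * (1 - Real.exp |q|) ≤ psi M u := by
  have key : ∀ v, M ≤ v → |q| * v + M * (1 - Real.exp |q|) ≤
      v * Real.log (v / M) - v + M := by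
    intro v hv
    have hM0 : 0 < M := by linarith
    have hv0 : 0 < v := by linarith
    have h := Real.add_one_le_exp (|q| - Real.log (v / M))
    rw [Real.exp_sub, Real.exp_log (by positivity)] at h
    have h2 := mul_le_mul_of_nonneg_left h hv0.le
    have h3 : v * (Real.exp |q| / (v / M)) = M * Real.exp |q| := by
      field_simp
    rw [h3] at h2
    nlinarith
  rcases le_total u M with h | h
  · have := key M le_rfl
    have hMM : M / M = 1 := div_self (by linarith)
    rw [hMM, Real.log_one] at this
    rw [psi_of_le hM h]
    nlinarith [abs_nonneg q]
  · rw [psi_of_ge h]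
    exact key u h

lemma psi_nonneg {M u : ℝ} (hM : 1 ≤ M) : 0 ≤ psi M u := by
  have := le_psi (u := u) hM 0
  simpa using this

lemma phi_nonneg {u : ℝ} (hu : 0 ≤ u) : 0 ≤ u * Real.log u + 1 - u := by
  rcases hu.eq_or_lt with h | h
  · subst h; simp
  · have := Real.one_sub_inv_le_log_of_pos h
    have h2 := mul_le_mul_of_nonneg_left this h.le
    rw [mul_sub, mul_inv_cancel₀ h.ne'] at h2
    linarith

lemma psi_le_phi {M u : ℝ} (hM : 1 ≤ M) (hu : 0 ≤ u) : psi M u ≤ u * Real.log u + 1 - u := by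
  rcases le_total u M with h | h
  · rw [psi_of_le hM h]; exact phi_nonneg hu
  · rw [psi_of_ge h, Real.log_div (by linarith) (by linarith)]
    have h1 := phi_nonneg (u := M) (by linarith)
    have h2 := mul_le_mul_of_nonneg_right h (Real.log_nonneg hM)
    linarith

lemma phi_le {M u : ℝ} (hM : 1 ≤ M) (hu : 0 ≤ u) :
    u * Real.log u + 1 - u ≤ M * |u - 1| + psi M u := by
  rcases le_total u M with h | h
  · rw [psi_of_le hM h]
    have h1 : u * Real.log u + 1 - u ≤ (u - 1) ^ 2 := by
      rcases hu.eq_or_lt with h | h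
      · subst h; simp
      · have := mul_le_mul_of_nonneg_left (Real.log_le_sub_one_of_pos h) h.le
        nlinarith
    have h2 : |u - 1| ≤ M := abs_le.2 ⟨by linarith, by linarith⟩
    have h3 := mul_le_mul_of_nonneg_right h2 (abs_nonneg (u - 1))
    rw [← sq, sq_abs] at h3
    linarith
  · rw [psi_of_ge h, Real.log_div (by linarith) (by linarith), abs_of_nonneg (by linarith)]
    have h1 := Real.log_le_sub_one_of_pos (x := M) (by linarith)
    have h2 := mul_le_mul_of_nonneg_right h1 (show 0 ≤ u - 1 by linarith)
    nlinarith

lemma ent_eq {f g : ℝ} (hg : 0 < g) :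
    f * Real.log (f / g) + g - f = g * (f / g * Real.log (f / g) + 1 - f / g) := by
  field_simp

lemma measurable_psi (M : ℝ) : Measurable (psi M) := by
  unfold psi
  fun_prop

section
variable {X : Type*} [MeasurableSpace X] {μ : Measure X}

lemma jensen (T : Lp ℝ 1 μ →ₗ[ℝ] Lp ℝ 1 μ)
    (hpos : ∀ f : Lp ℝ 1 μ, 0 ≤ f → 0 ≤ T f)
    (hint : ∀ f : Lp ℝ 1 μ, 0 ≤ f → ∫ x, (T f : X → ℝ) x ∂μ = ∫ x, (f : X → ℝ) x ∂μ)
    (g f : Lp ℝ 1 μ) (hg : ∀ᵐ x ∂μ, 0 < (g : X → ℝ) x) (hT : T g = g)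
    {M : ℝ} (hM : 1 ≤ M)
    (hI : Integrable (fun x => (g : X → ℝ) x * psi M ((f : X → ℝ) x / (g : X → ℝ) x)) μ) :
    ∫⁻ x, ENNReal.ofReal ((g : X → ℝ) x * psi M ((T f : X → ℝ) x / (g : X → ℝ) x)) ∂μ ≤
    ∫⁻ x, ENNReal.ofReal ((g : X → ℝ) x * psi M ((f : X → ℝ) x / (g : X → ℝ) x)) ∂μ := by
  set G : Lp ℝ 1 μ := hI.toL1 _ with hG
  have hGc := hI.coeFn_toL1
  rw [← hG] at hGc
  have hG0 : 0 ≤ G := by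
    rw [← Lp.coeFn_nonneg]
    filter_upwards [hGc, hg] with x hx hgx
    rw [hx]
    exact mul_nonneg hgx.le (psi_nonneg hM)
  have hq : ∀ q : ℝ, ∀ᵐ x ∂μ, |q| * (T f : X → ℝ) x + M * (1 - Real.exp |q|) * (g : X → ℝ) x
      ≤ (T G : X → ℝ) x := by
    intro q
    have h1 : |q| • f + (M * (1 - Real.exp |q|)) • g ≤ G := by
      rw [← Lp.coeFn_le]
      filter_upwards [hGc, hg, Lp.coeFn_add (|q| • f) ((M * (1 - Real.exp |q|)) • g),
        Lp.coeFn_smul |q| f, Lp.coeFn_smul (M * (1 - Real.exp |q|)) g] with x hx hgx h1 h2 h3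
      rw [hx, h1, Pi.add_apply, h2, h3, Pi.smul_apply, Pi.smul_apply, smul_eq_mul, smul_eq_mul]
      have := mul_le_mul_of_nonneg_left
        (le_psi (u := (f : X → ℝ) x / (g : X → ℝ) x) hM q) hgx.le
      have e : (g : X → ℝ) x * ((f : X → ℝ) x / (g : X → ℝ) x) = (f : X → ℝ) x :=
        mul_div_cancel₀ _ hgx.ne'
      calc _ = |q| * ((g : X → ℝ) x * ((f : X → ℝ) x / (g : X → ℝ) x)) +
            M * (1 - Real.exp |q|) * (g : X → ℝ) x := by rw [e]
        _ ≤ _ := by linarith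
    have h2 := hpos _ (sub_nonneg.2 h1)
    rw [map_sub, map_add, map_smul, map_smul, hT, sub_nonneg, ← Lp.coeFn_le] at h2
    filter_upwards [h2, Lp.coeFn_add (|q| • T f) ((M * (1 - Real.exp |q|)) • g),
        Lp.coeFn_smul |q| (T f), Lp.coeFn_smul (M * (1 - Real.exp |q|)) g] with x hx h1 h2 h3
    rw [h1, Pi.add_apply, h2, h3, Pi.smul_apply, Pi.smul_apply, smul_eq_mul, smul_eq_mul] at hx
    exact hx
  have hall : ∀ᵐ x ∂μ, (g : X → ℝ) x * psi M ((T f : X → ℝ) x / (g : X → ℝ) x)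
      ≤ (T G : X → ℝ) x := by
    have h := ae_all_iff.2 (fun q : ℚ => hq q)
    filter_upwards [h, hg] with x hx hgx
    have hreal : ∀ q : ℝ, |q| * (T f : X → ℝ) x + M * (1 - Real.exp |q|) * (g : X → ℝ) x
      ≤ (T G : X → ℝ) x := by
      intro q
      refine Rat.denseRange_cast.induction_on (p := fun q : ℝ =>
        |q| * (T f : X → ℝ) x + M * (1 - Real.exp |q|) * (g : X → ℝ) x
          ≤ (T G : X → ℝ) x) q ?_ hx
      exact isClosed_le (by fun_prop) (by fun_prop)
    obtain ⟨q, hq⟩ := psi_eq (u := (T f : X → ℝ) x / (g : X → ℝ) x) hM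
    rw [hq]
    refine le_trans (le_of_eq ?_) (hreal q)
    field_simp
  calc _ ≤ ∫⁻ x, ENNReal.ofReal ((T G : X → ℝ) x) ∂μ :=
        lintegral_mono_ae (hall.mono fun x hx => ENNReal.ofReal_le_ofReal hx)
    _ = ENNReal.ofReal (∫ x, (T G : X → ℝ) x ∂μ) :=
        (ofReal_integral_eq_lintegral_ofReal (L1.integrable_coeFn _)
          ((Lp.coeFn_nonneg _).2 (hpos _ hG0))).symm
    _ = ENNReal.ofReal (∫ x, (G : X → ℝ) x ∂μ) := by rw [hint _ hG0]
    _ = ∫⁻ x, ENNReal.ofReal ((G : X → ℝ) x) ∂μ :=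
        ofReal_integral_eq_lintegral_ofReal (L1.integrable_coeFn _) ((Lp.coeFn_nonneg _).2 hG0)
    _ = _ := lintegral_congr_ae (hGc.mono fun x hx => by simp only [hx])

end

end EntAux

/-- If a semigroup of Markov operators with stationary density `fstar` is asymptotically
stable, then the conditional entropy of `P^t f₀` relative to `fstar` tends to `0` for every
density `f₀` of finite conditional entropy. -/
theorem condEnt_tendsto_zero_of_asymptotically_stable
    {X : Type*} [MeasurableSpace X] {μ : Measure X} [SigmaFinite μ]
    (P : ℝ → Lp ℝ 1 μ →ₗ[ℝ] Lp ℝ 1 μ)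
    (hP_pos : ∀ t, 0 ≤ t → ∀ f : Lp ℝ 1 μ, 0 ≤ f → 0 ≤ P t f)
    (hP_int : ∀ t, 0 ≤ t → ∀ f : Lp ℝ 1 μ, 0 ≤ f →
      ∫ x, (P t f : X → ℝ) x ∂μ = ∫ x, (f : X → ℝ) x ∂μ)
    (hP_zero : P 0 = LinearMap.id)
    (hP_semigroup : ∀ t s, 0 ≤ t → 0 ≤ s → P (t + s) = (P t).comp (P s))
    (fstar : Lp ℝ 1 μ)
    (hfs_pos : ∀ᵐ x ∂μ, 0 < (fstar : X → ℝ) x)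
    (hfs_one : ∫ x, (fstar : X → ℝ) x ∂μ = 1)
    (hstat : ∀ t, 0 ≤ t → P t fstar = fstar)
    (hstable : ∀ f₀ : Lp ℝ 1 μ, 0 ≤ f₀ → ∫ x, (f₀ : X → ℝ) x ∂μ = 1 →
      Tendsto (fun t => ‖P t f₀ - fstar‖) atTop (nhds 0))
    (f₀ : Lp ℝ 1 μ) (hf₀_pos : 0 ≤ f₀) (hf₀_one : ∫ x, (f₀ : X → ℝ) x ∂μ = 1)
    (hfin : ⊥ < condEnt μ (f₀ : X → ℝ) (fstar : X → ℝ)) :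
    Tendsto (fun t => condEnt μ (P t f₀ : X → ℝ) (fstar : X → ℝ)) atTop (nhds (0 : EReal)) := by
  have hg0 := hfs_pos
  have hmeas : ∀ (M : ℝ) (f : Lp ℝ 1 μ), AEStronglyMeasurable
      (fun x => (fstar : X → ℝ) x * EntAux.psi M ((f : X → ℝ) x / (fstar : X → ℝ) x)) μ := by
    intro M f
    have h1 := (Lp.stronglyMeasurable f).measurable
    have h2 := (Lp.stronglyMeasurable fstar).measurable
    exact (h2.mul ((EntAux.measurable_psi M).comp (h1.div h2))).aestronglyMeasurable
  have hf0 : ∀ᵐ x ∂μ, 0 ≤ (f₀ : X → ℝ) x := (Lp.coeFn_nonneg _).2 hf₀_pos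
  have hfin' : ∫⁻ x, ENNReal.ofReal ((f₀ : X → ℝ) x * Real.log ((f₀ : X → ℝ) x /
      (fstar : X → ℝ) x) + (fstar : X → ℝ) x - (f₀ : X → ℝ) x) ∂μ ≠ ⊤ := by
    intro h
    unfold condEnt at hfin
    rw [h] at hfin
    simp at hfin
  have hdom : ∀ n : ℕ, ∀ᵐ x ∂μ, ENNReal.ofReal ((fstar : X → ℝ) x *
      EntAux.psi ((n : ℝ) + 1) ((f₀ : X → ℝ) x / (fstar : X → ℝ) x)) ≤
      ENNReal.ofReal ((f₀ : X → ℝ) x * Real.log ((f₀ : X → ℝ) x /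
      (fstar : X → ℝ) x) + (fstar : X → ℝ) x - (f₀ : X → ℝ) x) := by
    intro n
    filter_upwards [hf0, hg0] with x hfx hgx
    rw [EntAux.ent_eq hgx]
    have hn : (1 : ℝ) ≤ (n : ℝ) + 1 := by linarith [Nat.cast_nonneg (α := ℝ) n]
    exact ENNReal.ofReal_le_ofReal (mul_le_mul_of_nonneg_left
      (EntAux.psi_le_phi hn (div_nonneg hfx hgx.le)) hgx.le)
  have hlim : Tendsto (fun n : ℕ => ∫⁻ x, ENNReal.ofReal ((fstar : X → ℝ) x *
      EntAux.psi ((n : ℝ) + 1) ((f₀ : X → ℝ) x / (fstar : X → ℝ) x)) ∂μ) atTop (nhds 0) := by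
    have := tendsto_lintegral_of_dominated_convergence' (μ := μ) (f := fun _ => (0 : ℝ≥0∞))
      (F := fun (n : ℕ) x => ENNReal.ofReal ((fstar : X → ℝ) x *
      EntAux.psi ((n : ℝ) + 1) ((f₀ : X → ℝ) x / (fstar : X → ℝ) x))) _
      (fun n => (hmeas _ f₀).aemeasurable.ennreal_ofReal) hdom hfin' ?_
    · simpa using this
    · refine Eventually.of_forall fun x => ?_
      obtain ⟨N, hN⟩ := exists_nat_ge ((f₀ : X → ℝ) x / (fstar : X → ℝ) x)
      refine tendsto_const_nhds.congr' ?_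
      filter_upwards [eventually_ge_atTop N] with n hn
      have h1 : (N : ℝ) ≤ n := by exact_mod_cast hn
      rw [EntAux.psi_of_le (by linarith [Nat.cast_nonneg (α := ℝ) n]) (by linarith)]
      simp
  have hbound : ∀ (n : ℕ) (t : ℝ), 0 ≤ t →
      ∫⁻ x, ENNReal.ofReal ((P t f₀ : X → ℝ) x * Real.log ((P t f₀ : X → ℝ) x /
      (fstar : X → ℝ) x) + (fstar : X → ℝ) x - (P t f₀ : X → ℝ) x) ∂μ ≤
      ENNReal.ofReal (((n : ℝ) + 1) * ‖P t f₀ - fstar‖) +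
      ∫⁻ x, ENNReal.ofReal ((fstar : X → ℝ) x *
      EntAux.psi ((n : ℝ) + 1) ((f₀ : X → ℝ) x / (fstar : X → ℝ) x)) ∂μ := by
    intro n t ht
    have hn : (1 : ℝ) ≤ (n : ℝ) + 1 := by linarith [Nat.cast_nonneg (α := ℝ) n]
    have hI : Integrable (fun x => (fstar : X → ℝ) x *
        EntAux.psi ((n : ℝ) + 1) ((f₀ : X → ℝ) x / (fstar : X → ℝ) x)) μ := by
      rw [← lintegral_ofReal_ne_top_iff_integrable (hmeas _ _)
        (hg0.mono fun x hx => mul_nonneg hx.le (EntAux.psi_nonneg hn))]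
      exact ((lintegral_mono_ae (hdom n)).trans_lt hfin'.lt_top).ne
    refine le_trans ?_ (add_le_add_right (EntAux.jensen (P t) (hP_pos t ht) (hP_int t ht) fstar f₀
      hg0 (hstat t ht) hn hI) _)
    have hPf : ∀ᵐ x ∂μ, 0 ≤ (P t f₀ : X → ℝ) x := (Lp.coeFn_nonneg _).2 (hP_pos t ht _ hf₀_pos)
    have hnorm : ENNReal.ofReal (((n : ℝ) + 1) * ‖P t f₀ - fstar‖) =
        ∫⁻ x, ENNReal.ofReal (((n : ℝ) + 1) * ‖(P t f₀ - fstar : Lp ℝ 1 μ) x‖) ∂μ := by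
      rw [L1.norm_eq_integral_norm, ← integral_const_mul]
      exact ofReal_integral_eq_lintegral_ofReal
        ((L1.integrable_coeFn _).norm.const_mul _)
        (Eventually.of_forall fun x => mul_nonneg (by linarith) (norm_nonneg _))
    rw [hnorm, ← lintegral_add_right' _ (hmeas _ _).aemeasurable.ennreal_ofReal]
    refine lintegral_mono_ae ?_
    filter_upwards [hPf, hg0, Lp.coeFn_sub (P t f₀) fstar] with x hfx hgx hs
    rw [← ENNReal.ofReal_add (mul_nonneg (by linarith) (norm_nonneg _))
      (mul_nonneg hgx.le (EntAux.psi_nonneg hn)), hs, EntAux.ent_eq hgx, Pi.sub_apply]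
    refine ENNReal.ofReal_le_ofReal ?_
    have h := mul_le_mul_of_nonneg_left (EntAux.phi_le hn (div_nonneg hfx hgx.le)) hgx.le
    have e : (fstar : X → ℝ) x * |(P t f₀ : X → ℝ) x / (fstar : X → ℝ) x - 1| =
        |(P t f₀ : X → ℝ) x - (fstar : X → ℝ) x| := by
      rw [← abs_of_pos hgx, ← abs_mul, abs_of_pos hgx, mul_sub, mul_div_cancel₀ _ hgx.ne', mul_one]
    rw [Real.norm_eq_abs, ← e]
    linarith
  have hmain : Tendsto (fun t => ∫⁻ x, ENNReal.ofReal ((P t f₀ : X → ℝ) x *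
      Real.log ((P t f₀ : X → ℝ) x /
      (fstar : X → ℝ) x) + (fstar : X → ℝ) x - (P t f₀ : X → ℝ) x) ∂μ) atTop (nhds 0) := by
    rw [ENNReal.tendsto_nhds_zero]
    intro ε hε
    have hε2 : 0 < ε / 2 := ENNReal.half_pos hε.ne'
    obtain ⟨n, hn⟩ := (ENNReal.tendsto_nhds_zero.1 hlim (ε / 2) hε2).exists
    have hs : Tendsto (fun t => ENNReal.ofReal (((n : ℝ) + 1) * ‖P t f₀ - fstar‖)) atTop
        (nhds 0) := by
      have := ENNReal.tendsto_ofReal ((hstable f₀ hf₀_pos hf₀_one).const_mul ((n : ℝ) + 1))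
      simpa using this
    filter_upwards [ENNReal.tendsto_nhds_zero.1 hs (ε / 2) hε2, eventually_ge_atTop 0] with t h1 h2
    exact (hbound n t h2).trans ((add_le_add h1 hn).trans (ENNReal.add_halves ε).le)
  have h1 := (continuous_coe_ennreal_ereal.tendsto 0).comp hmain
  have h2 := (continuous_neg.tendsto _).comp h1
  simpa [condEnt, Function.comp_def] using h2
end

section
/- Let (X, Σ, μ) be a σ-finite measure space and {P^t}_{t≥0} a semigroup of Markov operators on L¹(μ) with a stationary density f_* (P^t f_* = f_* for all t ≥ 0), f_* > 0 a.e. Suppose that lim_{t→∞} H_c(P^t f₀ | f_*) = 0 for every density f₀ with H_c(f₀ | f_*) > −∞. Then the semigroup is asymptotically stable: ‖P^t f₀ − f_*‖_{L¹} → 0 as t → ∞ for every density f₀. -/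
open MeasureTheory Real Filter
open scoped ENNReal

lemma aux_pt {a b e : ℝ} (ha : 0 ≤ a) (hb : 0 < b) (he : 0 < e) :
    |a - b| ≤ e⁻¹ * (a * Real.log (a / b) + b - a) + e * (a + b) := by
  have key : (√a - √b) ^ 2 ≤ a * Real.log (a / b) + b - a := by
    rcases ha.eq_or_lt with rfl | ha'
    · simp [Real.sq_sqrt hb.le]
    · have h1 : Real.log (√b / √a) ≤ √b / √a - 1 :=
        Real.log_le_sub_one_of_pos (div_pos (Real.sqrt_pos.2 hb) (Real.sqrt_pos.2 ha'))
      rw [Real.log_div (Real.sqrt_pos.2 hb).ne' (Real.sqrt_pos.2 ha').ne',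
        Real.log_sqrt hb.le, Real.log_sqrt ha] at h1
      rw [Real.log_div ha'.ne' hb.ne']
      have h2 : a * (√b / √a) = √a * √b := by
        have := (Real.sqrt_pos.2 ha').ne'
        field_simp
        rw [Real.sq_sqrt ha]
      have h3 := mul_le_mul_of_nonneg_left h1 ha
      nlinarith [Real.sq_sqrt ha, Real.sq_sqrt hb.le]
  have h4 : |a - b| = |√a - √b| * (√a + √b) := by
    rw [← abs_of_nonneg (add_nonneg (Real.sqrt_nonneg a) (Real.sqrt_nonneg b)), ← abs_mul]
    congr 1
    nlinarith [Real.sq_sqrt ha, Real.sq_sqrt hb.le]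
  have h5 : e⁻¹ * (√a - √b) ^ 2 ≤ e⁻¹ * (a * Real.log (a / b) + b - a) :=
    mul_le_mul_of_nonneg_left key (inv_pos.2 he).le
  refine le_trans ?_ (add_le_add_left h5 _)
  rw [h4]
  set u := |√a - √b| with hu
  have hu2 : (√a - √b) ^ 2 = u ^ 2 := by rw [hu, sq_abs]
  rw [hu2]
  set s := √a + √b
  have hs : s ^ 2 ≤ 2 * (a + b) := by
    nlinarith [Real.sq_sqrt ha, Real.sq_sqrt hb.le, sq_nonneg (√a - √b)]
  have h6 : u * s ≤ e⁻¹ * u ^ 2 + e * (s ^ 2 / 2) := by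
    have h7 : 0 ≤ e⁻¹ * (u - e * s / 2) ^ 2 := by positivity
    have h8 : e⁻¹ * (u - e * s / 2) ^ 2 = e⁻¹ * u ^ 2 - u * s + e * s ^ 2 / 4 := by
      field_simp
      ring
    have : 0 ≤ e * s ^ 2 := by positivity
    linarith
  have h9 : e * (s ^ 2 / 2) ≤ e * (a + b) := mul_le_mul_of_nonneg_left (by linarith) he.le
  linarith

section aux
variable {X : Type*} [MeasurableSpace X] {μ : Measure X}

lemma aux_int_add (f g : Lp ℝ 1 μ) :
    ∫ x, ((f + g : Lp ℝ 1 μ) : X → ℝ) x ∂μ = ∫ x, (f : X → ℝ) x ∂μ + ∫ x, (g : X → ℝ) x ∂μ := by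
  rw [← integral_add (L1.integrable_coeFn f) (L1.integrable_coeFn g)]
  exact integral_congr_ae (Lp.coeFn_add f g)

lemma aux_int_smul (c : ℝ) (f : Lp ℝ 1 μ) :
    ∫ x, ((c • f : Lp ℝ 1 μ) : X → ℝ) x ∂μ = c * ∫ x, (f : X → ℝ) x ∂μ := by
  rw [← integral_const_mul]
  exact integral_congr_ae (Lp.coeFn_smul c f)

lemma aux_smul_nonneg {c : ℝ} (hc : 0 ≤ c) {f : Lp ℝ 1 μ} (hf : 0 ≤ f) : 0 ≤ c • f := by
  rw [← Lp.coeFn_nonneg] at hf ⊢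
  filter_upwards [hf, Lp.coeFn_smul c f] with x hx hy
  rw [hy]
  exact mul_nonneg hc hx

lemma aux_norm_pos (f : Lp ℝ 1 μ) (hf : 0 ≤ f) : ‖f‖ = ∫ x, (f : X → ℝ) x ∂μ := by
  rw [L1.norm_eq_integral_norm]
  refine integral_congr_ae ?_
  filter_upwards [(Lp.coeFn_nonneg f).2 hf] with x hx
  exact abs_of_nonneg hx

lemma aux_contr (T : Lp ℝ 1 μ →ₗ[ℝ] Lp ℝ 1 μ)
    (hpos : ∀ f : Lp ℝ 1 μ, 0 ≤ f → 0 ≤ T f)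
    (hint : ∀ f : Lp ℝ 1 μ, 0 ≤ f → ∫ x, (T f : X → ℝ) x ∂μ = ∫ x, (f : X → ℝ) x ∂μ)
    (f : Lp ℝ 1 μ) : ‖T f‖ ≤ ‖f‖ := by
  have h : ∀ g : Lp ℝ 1 μ, 0 ≤ g → ‖T g‖ = ∫ x, (g : X → ℝ) x ∂μ := fun g hg => by
    rw [aux_norm_pos _ (hpos g hg), hint g hg]
  calc ‖T f‖ = ‖T f⁺ - T f⁻‖ := by rw [← map_sub, posPart_sub_negPart]
    _ ≤ ‖T f⁺‖ + ‖T f⁻‖ := norm_sub_le _ _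
    _ = ‖|f|‖ := by
      rw [h _ (posPart_nonneg f), h _ (negPart_nonneg f), ← aux_int_add, posPart_add_negPart,
        aux_norm_pos _ (abs_nonneg f)]
    _ = ‖f‖ := norm_abs_eq_norm f

lemma aux_bound (f g : Lp ℝ 1 μ) (hf : 0 ≤ f) (hg : ∀ᵐ x ∂μ, 0 < (g : X → ℝ) x)
    (hf1 : ∫ x, (f : X → ℝ) x ∂μ = 1) (hg1 : ∫ x, (g : X → ℝ) x ∂μ = 1) {e : ℝ} (he : 0 < e) :
    ENNReal.ofReal ‖f - g‖ ≤ ENNReal.ofReal e⁻¹ *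
      (∫⁻ x, ENNReal.ofReal (f x * Real.log (f x / g x) + g x - f x) ∂μ)
      + ENNReal.ofReal (2 * e) := by
  have hfi := L1.integrable_coeFn f
  have hgi := L1.integrable_coeFn g
  have h0 := (Lp.coeFn_nonneg f).2 hf
  have e1 : ENNReal.ofReal ‖f - g‖ = ∫⁻ x, ENNReal.ofReal |f x - g x| ∂μ := by
    rw [L1.norm_eq_integral_norm, ofReal_integral_norm_eq_lintegral_enorm (L1.integrable_coeFn _)]
    refine lintegral_congr_ae ?_
    filter_upwards [Lp.coeFn_sub f g] with x hx
    rw [hx, ← ofReal_norm]; rfl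
  have e2 : ENNReal.ofReal (2 * e) = ∫⁻ x, ENNReal.ofReal (e * (f x + g x)) ∂μ := by
    have hi : Integrable (fun x => e * (f x + g x)) μ := (hfi.add hgi).const_mul e
    rw [← ofReal_integral_eq_lintegral_ofReal hi]
    · rw [integral_const_mul, integral_add hfi hgi, hf1, hg1]
      congr 1; ring
    · filter_upwards [h0, hg] with x hx hy
      exact mul_nonneg he.le (add_nonneg hx hy.le)
  have hm : AEMeasurable (fun x => ENNReal.ofReal (e * (f x + g x))) μ :=
    ((hfi.add hgi).const_mul e).aestronglyMeasurable.aemeasurable.ennreal_ofReal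
  rw [e1, e2, ← lintegral_const_mul' _ _ ENNReal.ofReal_ne_top, ← lintegral_add_right' _ hm]
  refine lintegral_mono_ae ?_
  filter_upwards [h0, hg] with x hx hy
  rw [← ENNReal.ofReal_mul (inv_pos.2 he).le]
  exact (ENNReal.ofReal_le_ofReal (aux_pt hx hy he)).trans ENNReal.ofReal_add_le

lemma aux_ent (f g : Lp ℝ 1 μ) (hf : 0 ≤ f) (hg : ∀ᵐ x ∂μ, 0 < (g : X → ℝ) x) {K : ℝ}
    (hK : 1 ≤ K) (hfg : ∀ᵐ x ∂μ, f x ≤ K * g x) :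
    ⊥ < condEnt μ (f : X → ℝ) (g : X → ℝ) := by
  have hfi := L1.integrable_coeFn f
  have hgi := L1.integrable_coeFn g
  have hlt : (∫⁻ x, ENNReal.ofReal (f x * Real.log (f x / g x) + g x - f x) ∂μ) < ⊤ := by
    have hi : Integrable (fun x => f x * Real.log K + g x) μ := (hfi.mul_const _).add hgi
    refine lt_of_le_of_lt (lintegral_mono_ae ?_) hi.lintegral_lt_top
    filter_upwards [(Lp.coeFn_nonneg f).2 hf, hg, hfg] with x hx hy hxy
    have hx : 0 ≤ f x := hx
    apply ENNReal.ofReal_le_ofReal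
    have : f x * Real.log (f x / g x) ≤ f x * Real.log K := by
      rcases hx.eq_or_lt with h | h
      · simp [← h]
      · refine mul_le_mul_of_nonneg_left (Real.log_le_log (div_pos h hy) ?_) hx
        rwa [div_le_iff₀ hy]
    linarith
  rw [condEnt, bot_lt_iff_ne_bot, Ne, EReal.neg_eq_bot_iff]
  simpa using hlt.ne

lemma aux_dense_s3 (f g : Lp ℝ 1 μ) (hf : 0 ≤ f) (hg : ∀ᵐ x ∂μ, 0 < (g : X → ℝ) x)
    (hf1 : ∫ x, (f : X → ℝ) x ∂μ = 1) (hg1 : ∫ x, (g : X → ℝ) x ∂μ = 1) {e : ℝ} (he : 0 < e) :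
    ∃ h : Lp ℝ 1 μ, 0 ≤ h ∧ ∫ x, (h : X → ℝ) x ∂μ = 1 ∧ ‖f - h‖ ≤ e ∧
      ⊥ < condEnt μ (h : X → ℝ) (g : X → ℝ) := by
  have hfi := L1.integrable_coeFn f
  have h0 := (Lp.coeFn_nonneg f).2 hf
  have hg0 : 0 ≤ g := (Lp.coeFn_nonneg g).1 (hg.mono fun x hx => hx.le)
  have hcoe : ∀ n : ℕ, ∀ᵐ x ∂μ, ((f ⊓ (n : ℝ) • g : Lp ℝ 1 μ) : X → ℝ) x = min (f x) (n * g x) := by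
    intro n
    filter_upwards [Lp.coeFn_inf f ((n : ℝ) • g), Lp.coeFn_smul (n : ℝ) g] with x hx hy
    rw [hx, Pi.inf_apply, hy]; rfl
  have hlim : Tendsto (fun n : ℕ => ∫ x, ((f ⊓ (n : ℝ) • g : Lp ℝ 1 μ) : X → ℝ) x ∂μ) atTop
      (nhds 1) := by
    rw [← hf1]
    refine tendsto_integral_of_dominated_convergence (fun x => f x)
      (fun n => Lp.aestronglyMeasurable _) hfi ?_ ?_
    · intro n
      filter_upwards [hcoe n, h0, hg] with x hx hy hz
      have hy : 0 ≤ f x := hy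
      rw [hx, Real.norm_of_nonneg (le_min hy (by positivity))]
      exact min_le_left _ _
    · filter_upwards [ae_all_iff.2 hcoe, hg] with x hx hz
      simp_rw [hx]
      obtain ⟨N, hN⟩ := exists_nat_ge (f x / g x)
      refine tendsto_const_nhds.congr' ?_
      filter_upwards [eventually_ge_atTop N] with n hn
      rw [min_eq_left]
      rw [div_le_iff₀ hz] at hN
      exact hN.trans (mul_le_mul_of_nonneg_right (by exact_mod_cast hn) hz.le)
  obtain ⟨n, hn⟩ := (hlim.eventually (lt_mem_nhds (show 1 - e / 2 < 1 by linarith))).exists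
  set q : Lp ℝ 1 μ := f ⊓ (n : ℝ) • g with hq
  set c := ∫ x, (q : X → ℝ) x ∂μ with hc
  have hq0 : 0 ≤ q := le_inf hf (aux_smul_nonneg (by positivity) hg0)
  have hqf : 0 ≤ f - q := sub_nonneg.2 inf_le_left
  have hfq : ‖f - q‖ = 1 - c := by
    rw [aux_norm_pos _ hqf]
    have := aux_int_add (f - q) q
    rw [sub_add_cancel, hf1] at this
    linarith
  have hc1 : 0 ≤ 1 - c := hfq ▸ norm_nonneg _
  have hng : ‖g‖ = 1 := by rw [aux_norm_pos g hg0, hg1]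
  have hh0 : 0 ≤ q + (1 - c) • g := add_nonneg hq0 (aux_smul_nonneg hc1 hg0)
  refine ⟨q + (1 - c) • g, hh0, ?_, ?_, ?_⟩
  · rw [aux_int_add, aux_int_smul, hg1, ← hc]; ring
  · calc ‖f - (q + (1 - c) • g)‖ = ‖(f - q) - (1 - c) • g‖ := by rw [sub_sub]
      _ ≤ ‖f - q‖ + ‖(1 - c) • g‖ := norm_sub_le _ _
      _ = (1 - c) + (1 - c) := by
        rw [hfq, norm_smul, hng, Real.norm_of_nonneg hc1, mul_one]
      _ ≤ e := by linarith
  · refine aux_ent _ g hh0 hg (K := n + 1) (by linarith [Nat.cast_nonneg (α := ℝ) n]) ?_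
    have hc0 : 0 ≤ c := by rw [hc, ← aux_norm_pos q hq0]; exact norm_nonneg _
    filter_upwards [Lp.coeFn_add q ((1 - c) • g), Lp.coeFn_smul (1 - c) g, hcoe n, hg]
      with x h1 h2 h3 h4
    rw [h1, Pi.add_apply, h2, h3, Pi.smul_apply, smul_eq_mul]
    have := min_le_right (f x) (n * g x)
    nlinarith

end aux

/-- If the conditional entropy `H_c(P^t f₀ | fstar)` tends to `0` for every density `f₀` of
finite conditional entropy, then the semigroup of Markov operators is asymptotically stable. -/
theorem asymptotically_stable_of_condEnt_tendsto_zero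
    {X : Type*} [MeasurableSpace X] {μ : Measure X} [SigmaFinite μ]
    (P : ℝ → Lp ℝ 1 μ →ₗ[ℝ] Lp ℝ 1 μ)
    (hP_pos : ∀ t, 0 ≤ t → ∀ f : Lp ℝ 1 μ, 0 ≤ f → 0 ≤ P t f)
    (hP_int : ∀ t, 0 ≤ t → ∀ f : Lp ℝ 1 μ, 0 ≤ f →
      ∫ x, (P t f : X → ℝ) x ∂μ = ∫ x, (f : X → ℝ) x ∂μ)
    (hP_zero : P 0 = LinearMap.id)
    (hP_semigroup : ∀ t s, 0 ≤ t → 0 ≤ s → P (t + s) = (P t).comp (P s))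
    (fstar : Lp ℝ 1 μ)
    (hfs_pos : ∀ᵐ x ∂μ, 0 < (fstar : X → ℝ) x)
    (hfs_one : ∫ x, (fstar : X → ℝ) x ∂μ = 1)
    (hstat : ∀ t, 0 ≤ t → P t fstar = fstar)
    (hent : ∀ f₀ : Lp ℝ 1 μ, 0 ≤ f₀ → ∫ x, (f₀ : X → ℝ) x ∂μ = 1 →
      ⊥ < condEnt μ (f₀ : X → ℝ) (fstar : X → ℝ) →
      Tendsto (fun t => condEnt μ (P t f₀ : X → ℝ) (fstar : X → ℝ)) atTop (nhds (0 : EReal))) :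
    ∀ f₀ : Lp ℝ 1 μ, 0 ≤ f₀ → ∫ x, (f₀ : X → ℝ) x ∂μ = 1 →
      Tendsto (fun t => ‖P t f₀ - fstar‖) atTop (nhds 0) := by
  intro f₀ hf0 hf1
  have contr : ∀ t, 0 ≤ t → ∀ f, ‖P t f‖ ≤ ‖f‖ := fun t ht f =>
    aux_contr (P t) (hP_pos t ht) (hP_int t ht) f
  rw [Metric.tendsto_nhds]
  intro ε hε
  set e := ε / 5 with he'
  have he : 0 < e := by positivity
  obtain ⟨h, hh0, hh1, hfh, hhe⟩ := aux_dense_s3 f₀ fstar hf0 hfs_pos hf1 hfs_one he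
  have hev : ∀ᶠ t in atTop, -((ENNReal.ofReal (e * e) : ℝ≥0∞) : EReal) <
      condEnt μ (P t h : X → ℝ) (fstar : X → ℝ) := by
    refine (hent h hh0 hh1 hhe).eventually (lt_mem_nhds ?_)
    rw [EReal.neg_lt_zero]
    exact_mod_cast ENNReal.ofReal_pos.2 (mul_pos he he)
  filter_upwards [hev, eventually_ge_atTop 0] with t ht ht0
  rw [condEnt, EReal.neg_lt_neg_iff, EReal.coe_ennreal_lt_coe_ennreal_iff] at ht
  have hb := aux_bound (P t h) fstar (hP_pos t ht0 h hh0) hfs_pos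
    ((hP_int t ht0 h hh0).trans hh1) hfs_one he
  have hb2 : ENNReal.ofReal ‖P t h - fstar‖ ≤ ENNReal.ofReal (3 * e) := by
    refine hb.trans ((add_le_add_left (mul_le_mul_right ht.le _) _).trans ?_)
    rw [← ENNReal.ofReal_mul (inv_pos.2 he).le, ← ENNReal.ofReal_add (by positivity) (by positivity)]
    apply ENNReal.ofReal_le_ofReal
    rw [inv_mul_cancel_left₀ he.ne']
    linarith
  rw [ENNReal.ofReal_le_ofReal_iff (by positivity)] at hb2
  rw [Real.dist_eq, sub_zero, abs_of_nonneg (norm_nonneg _)]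
  calc ‖P t f₀ - fstar‖ = ‖P t (f₀ - h) + (P t h - fstar)‖ := by rw [map_sub]; congr 1; abel
    _ ≤ ‖P t (f₀ - h)‖ + ‖P t h - fstar‖ := norm_add_le _ _
    _ ≤ e + 3 * e := add_le_add ((contr t ht0 _).trans hfh) hb2
    _ < ε := by rw [he']; linarith
end

section
/- Let (X, Σ, μ) be a σ-finite measure space and {P^t}_{t≥0} an asymptotically stable semigroup of Markov operators on L¹(μ) with stationary density f_* > 0 a.e. Assume there exists ε > 0 such that ∫ f_*^{1+r} dμ < ∞ for every r ∈ (−ε, ε). Then for every density f₀ with H_c(f₀ | f_*) > −∞, the Gibbs entropy of P^t f₀ converges to the Gibbs entropy of f_*: lim_{t→∞} H_G(P^t f₀) = H_G(f_*). -/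
open MeasureTheory Real Filter
open scoped ENNReal

/-- The Gibbs entropy `H_G(f) = -∫ f log f dμ`. -/
noncomputable def gibbsEnt {X : Type*} [MeasurableSpace X] (μ : Measure X)
    (f : X → ℝ) : ℝ :=
  - ∫ x, f x * Real.log (f x) ∂μ


lemma aux_tangent (a b q : ℝ) (ha : 0 ≤ a) (hb : 0 < b) (hq : 0 < q) :
    a * Real.log q - (q - 1) * b ≤ a * Real.log (a / b) + b - a := by
  rcases ha.eq_or_lt with rfl | ha
  · simp; nlinarith
  · have h := Real.log_le_sub_one_of_pos (show 0 < q / (a / b) by positivity)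
    rw [Real.log_div hq.ne' (by positivity)] at h
    have h2 := mul_le_mul_of_nonneg_left h ha.le
    have h3 : a * (q / (a / b) - 1) = q * b - a := by field_simp
    rw [h3] at h2
    linarith

lemma aux_sup (a b c : ℝ) (ha : 0 ≤ a) (hb : 0 < b)
    (h : ∀ q : ℚ, 0 < q → a * Real.log q - ((q : ℝ) - 1) * b ≤ c) :
    a * Real.log (a / b) + b - a ≤ c := by
  have key : ∀ x : ℝ, 0 < x → a * Real.log x - (x - 1) * b ≤ c := by
    intro x hx
    by_contra hc
    push Not at hc
    have hcont : ContinuousAt (fun x : ℝ => a * Real.log x - (x - 1) * b) x := by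
      have := Real.continuousAt_log hx.ne'
      fun_prop
    have h1 := hcont.eventually (lt_mem_nhds hc)
    have h2 := h1.and (lt_mem_nhds hx)
    obtain ⟨q, hq1, hq2⟩ := Rat.denseRange_cast.exists_mem_open isOpen_interior
      ⟨x, mem_interior_iff_mem_nhds.2 h2⟩ |>.imp fun q hq => interior_subset hq
    exact absurd (h q (by exact_mod_cast hq2)) (not_le.2 hq1)
  rcases ha.eq_or_lt with rfl | ha
  · by_contra hc
    push Not at hc
    simp at hc key
    have h1 := key ((b - c) / (2 * b)) (by apply div_pos <;> linarith)
    have h2 : ((b - c) / (2 * b) - 1) * b = (b - c) / 2 - b := by field_simp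
    rw [h2] at h1
    linarith
  · have h1 := key (a / b) (by positivity)
    have h2 : (a / b - 1) * b = a - b := by field_simp
    rw [h2] at h1
    linarith

lemma aux_young (a b r : ℝ) (ha : 0 ≤ a) (hb : 0 < b) (hr : 0 < r) :
    |a * Real.log a| ≤ (1 + 1 / r) * (a * Real.log (a / b) + b - a) + a + b
      + (1 / r) * (b ^ (1 + r) + b ^ (1 + -r)) := by
  set p := a * Real.log (a / b) + b - a with hp
  have h0 : 0 ≤ p := by
    have := aux_tangent a b 1 ha hb one_pos
    rw [Real.log_one] at this
    linarith
  have h1 := aux_tangent a b (b ^ r) ha hb (by positivity)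
  have h2 := aux_tangent a b (b ^ (-r)) ha hb (by positivity)
  rw [Real.log_rpow hb] at h1 h2
  have e1 : b ^ (1 + r) = b * b ^ r := by rw [Real.rpow_add hb, Real.rpow_one]
  have e2 : b ^ (1 + -r) = b * b ^ (-r) := by rw [Real.rpow_add hb, Real.rpow_one]
  have p1 : 0 < b ^ (1 + r) := by positivity
  have p2 : 0 < b ^ (1 + -r) := by positivity
  set w := b ^ (1 + r) + b ^ (1 + -r) with hw
  have h4 : r * |a * Real.log b| ≤ p + w := by
    have e : r * |a * Real.log b| = |r * (a * Real.log b)| := by rw [abs_mul r, abs_of_pos hr]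
    rw [e, abs_le]
    constructor <;> nlinarith
  have h5 : |a * Real.log b| ≤ (1 / r) * (p + w) := by
    rw [one_div, ← div_eq_inv_mul, le_div_iff₀ hr]; linarith
  have h6 : a * Real.log a = p - b + a + a * Real.log b := by
    rcases ha.eq_or_lt with rfl | ha
    · simp [hp]
    · rw [hp, Real.log_div ha.ne' hb.ne']; ring
  rw [h6]
  have h7 : |p - b + a + a * Real.log b| ≤ (p + b + a) + |a * Real.log b| := by
    refine (abs_add_le _ _).trans (add_le_add_left ?_ _)
    rw [abs_le]; constructor <;> linarith
  have : (1 + 1 / r) * p + a + b + (1 / r) * w = (p + b + a) + (1 / r) * (p + w) := by ring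
  linarith

lemma aux_pratt {X : Type*} [MeasurableSpace X] {μ : Measure X}
    (a G : ℕ → X → ℝ) (A B : X → ℝ)
    (ha : ∀ n, AEStronglyMeasurable (a n) μ) (hG : ∀ n, Integrable (G n) μ)
    (hB : Integrable B μ)
    (hle : ∀ n, ∀ᵐ x ∂μ, |a n x| ≤ G n x)
    (hAB : ∀ᵐ x ∂μ, |A x| ≤ B x)
    (hlim : ∀ᵐ x ∂μ, Tendsto (fun n => a n x) atTop (nhds (A x)))
    (hGl : Tendsto (fun n => ∫ x, |G n x - B x| ∂μ) atTop (nhds 0)) :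
    Tendsto (fun n => ∫ x, a n x ∂μ) atTop (nhds (∫ x, A x ∂μ)) := by
  have hai : ∀ n, Integrable (a n) μ := fun n => (hG n).mono' (ha n) (hle n)
  let c : ℕ → X → ℝ := fun n x => max (-B x) (min (a n x) (B x))
  have hB0 : ∀ᵐ x ∂μ, 0 ≤ B x := hAB.mono fun x hx => (abs_nonneg _).trans hx
  have hcm : ∀ n, AEStronglyMeasurable (c n) μ := fun n =>
    hB.1.neg.sup ((ha n).inf hB.1)
  have hcb : ∀ n, ∀ᵐ x ∂μ, ‖c n x‖ ≤ B x := fun n => by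
    filter_upwards [hB0] with x hx
    rw [Real.norm_eq_abs, abs_le]
    exact ⟨le_max_left _ _, max_le (by linarith) (min_le_right _ _)⟩
  have hci : ∀ n, Integrable (c n) μ := fun n => hB.mono' (hcm n) (hcb n)
  have hc : Tendsto (fun n => ∫ x, c n x ∂μ) atTop (nhds (∫ x, A x ∂μ)) := by
    refine tendsto_integral_of_dominated_convergence B hcm hB hcb ?_
    filter_upwards [hlim, hAB] with x hx hab
    have h1 : Tendsto (fun n => c n x) atTop (nhds (max (-B x) (min (A x) (B x)))) :=
      tendsto_const_nhds.max (hx.min tendsto_const_nhds)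
    rw [abs_le] at hab
    rwa [min_eq_left hab.2, max_eq_right hab.1] at h1
  have hd : Tendsto (fun n => ∫ x, (a n x - c n x) ∂μ) atTop (nhds 0) := by
    refine squeeze_zero_norm (fun n => ?_) hGl
    refine norm_integral_le_of_norm_le ((hG n).sub hB).abs ?_
    filter_upwards [hle n, hB0] with x hx h0
    rw [abs_le] at hx
    have := le_abs_self (G n x - B x)
    have := abs_nonneg (G n x - B x)
    simp only [c]
    rw [Real.norm_eq_abs, abs_le]
    rcases le_total (a n x) (B x) with h | h
    · rw [min_eq_left h]
      rcases le_total (-B x) (a n x) with h' | h'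
      · rw [max_eq_right h']; constructor <;> linarith
      · rw [max_eq_left h']; constructor <;> linarith
    · rw [min_eq_right h, max_eq_right (by linarith)]
      constructor <;> linarith
  have := hd.add hc
  simp only [zero_add] at this
  refine this.congr fun n => ?_
  rw [integral_sub (hai n) (hci n)]; ring

lemma aux_norm {X : Type*} [MeasurableSpace X] {μ : Measure X} (f g : Lp ℝ 1 μ) :
    ‖f - g‖ = ∫ x, |(f : X → ℝ) x - (g : X → ℝ) x| ∂μ := by
  rw [L1.norm_eq_integral_norm]
  refine integral_congr_ae ?_
  filter_upwards [Lp.coeFn_sub f g] with x hx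
  rw [hx, Pi.sub_apply, Real.norm_eq_abs]

lemma aux_ae {X : Type*} [MeasurableSpace X] {μ : Measure X} (f : ℕ → Lp ℝ 1 μ) (g : Lp ℝ 1 μ)
    (h : Tendsto (fun n => ‖f n - g‖) atTop (nhds 0)) :
    ∃ ns : ℕ → ℕ, StrictMono ns ∧
      ∀ᵐ x ∂μ, Tendsto (fun i => (f (ns i) : X → ℝ) x) atTop (nhds ((g : X → ℝ) x)) := by
  have h1 : Tendsto f atTop (nhds g) := tendsto_iff_norm_sub_tendsto_zero.2 h
  exact (tendstoInMeasure_of_tendsto_Lp h1).exists_seq_tendsto_ae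

lemma aux_smul {X : Type*} [MeasurableSpace X] {μ : Measure X} (c : ℝ) (hc : 0 ≤ c)
    (g : Lp ℝ 1 μ) (hg : 0 ≤ g) : 0 ≤ c • g := by
  rw [← Lp.coeFn_nonneg] at hg ⊢
  filter_upwards [hg, Lp.coeFn_smul c g] with x h1 h2
  rw [h2]
  exact mul_nonneg hc h1

lemma aux_stable {X : Type*} [MeasurableSpace X] {μ : Measure X}
    (P : ℝ → Lp ℝ 1 μ →ₗ[ℝ] Lp ℝ 1 μ) (fstar : Lp ℝ 1 μ)
    (hstable : ∀ f₀ : Lp ℝ 1 μ, 0 ≤ f₀ → ∫ x, (f₀ : X → ℝ) x ∂μ = 1 →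
      Tendsto (fun t => ‖P t f₀ - fstar‖) atTop (nhds 0))
    (g : Lp ℝ 1 μ) (hg : 0 ≤ g) :
    Tendsto (fun t => ‖P t g - ‖g‖ • fstar‖) atTop (nhds 0) := by
  by_cases h0 : g = 0
  · simp [h0]
  have hn : 0 < ‖g‖ := norm_pos_iff.2 h0
  have hint : ∫ x, (g : X → ℝ) x ∂μ = ‖g‖ := by
    rw [L1.norm_eq_integral_norm]
    refine integral_congr_ae ?_
    filter_upwards [(Lp.coeFn_nonneg g).2 hg] with x hx
    exact (Real.norm_of_nonneg hx).symm
  have h1 := hstable (‖g‖⁻¹ • g) (aux_smul _ (by positivity) _ hg) (by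
    rw [integral_congr_ae (Lp.coeFn_smul _ g)]
    simp only [Pi.smul_apply, smul_eq_mul]
    rw [integral_const_mul, hint, inv_mul_cancel₀ hn.ne'])
  have h2 := h1.const_mul ‖g‖
  rw [mul_zero] at h2
  refine h2.congr fun t => ?_
  rw [map_smul]
  nth_rewrite 1 [← norm_norm g]
  rw [← norm_smul, smul_sub, smul_inv_smul₀ hn.ne']

lemma aux_dom {X : Type*} [MeasurableSpace X] {μ : Measure X}
    (P : Lp ℝ 1 μ →ₗ[ℝ] Lp ℝ 1 μ)
    (hP_pos : ∀ f : Lp ℝ 1 μ, 0 ≤ f → 0 ≤ P f)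
    (u f φ : Lp ℝ 1 μ) (hu : ∀ᵐ x ∂μ, 0 < (u : X → ℝ) x) (hPu : P u = u) (hf : 0 ≤ f)
    (hφ : ∀ᵐ x ∂μ, (φ : X → ℝ) x =
      (f : X → ℝ) x * Real.log ((f : X → ℝ) x / (u : X → ℝ) x) + (u : X → ℝ) x - (f : X → ℝ) x) :
    ∀ᵐ x ∂μ, (P f : X → ℝ) x * Real.log ((P f : X → ℝ) x / (u : X → ℝ) x)
      + (u : X → ℝ) x - (P f : X → ℝ) x ≤ (P φ : X → ℝ) x := by
  have hq : ∀ q : ℚ, ∀ᵐ x ∂μ, 0 < q →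
      (P f : X → ℝ) x * Real.log q - ((q : ℝ) - 1) * (u : X → ℝ) x ≤ (P φ : X → ℝ) x := by
    intro q
    by_cases hq0 : 0 < q
    swap
    · simp [hq0]
    have h1 : Real.log q • f - ((q : ℝ) - 1) • u ≤ φ := by
      rw [← Lp.coeFn_le]
      filter_upwards [Lp.coeFn_sub (Real.log q • f) (((q : ℝ) - 1) • u),
        Lp.coeFn_smul (Real.log q) f, Lp.coeFn_smul ((q : ℝ) - 1) u, hu, hφ,
        (Lp.coeFn_nonneg f).2 hf] with x e1 e2 e3 h4 h5 h6
      rw [e1, Pi.sub_apply, e2, e3, h5]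
      simp only [Pi.smul_apply, smul_eq_mul]
      have := aux_tangent _ _ (q : ℝ) h6 h4 (by exact_mod_cast hq0)
      linarith
    have h2 := hP_pos _ (sub_nonneg.2 h1)
    rw [map_sub, map_sub, map_smul, map_smul, hPu, sub_nonneg, ← Lp.coeFn_le] at h2
    filter_upwards [h2, Lp.coeFn_sub (Real.log q • P f) (((q : ℝ) - 1) • u),
        Lp.coeFn_smul (Real.log q) (P f), Lp.coeFn_smul ((q : ℝ) - 1) u] with x h e1 e2 e3 _
    rw [e1, Pi.sub_apply, e2, e3] at h
    simp only [Pi.smul_apply, smul_eq_mul] at h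
    linarith
  filter_upwards [ae_all_iff.2 hq, hu, (Lp.coeFn_nonneg _).2 (hP_pos f hf)] with x h1 h2 h3
  exact aux_sup _ _ _ h3 h2 h1

/-- For an asymptotically stable semigroup of Markov operators with stationary density
`fstar` satisfying `∫ fstar^{1+r} dμ < ∞` for all `r` in a neighborhood of `0`, the Gibbs
entropy of `P^t f₀` converges to the Gibbs entropy of `fstar` for every density `f₀` of finite
conditional entropy. -/
theorem gibbsEnt_tendsto_of_asymptotically_stable
    {X : Type*} [MeasurableSpace X] {μ : Measure X} [SigmaFinite μ]
    (P : ℝ → Lp ℝ 1 μ →ₗ[ℝ] Lp ℝ 1 μ)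
    (hP_pos : ∀ t, 0 ≤ t → ∀ f : Lp ℝ 1 μ, 0 ≤ f → 0 ≤ P t f)
    (hP_int : ∀ t, 0 ≤ t → ∀ f : Lp ℝ 1 μ, 0 ≤ f →
      ∫ x, (P t f : X → ℝ) x ∂μ = ∫ x, (f : X → ℝ) x ∂μ)
    (hP_zero : P 0 = LinearMap.id)
    (hP_semigroup : ∀ t s, 0 ≤ t → 0 ≤ s → P (t + s) = (P t).comp (P s))
    (fstar : Lp ℝ 1 μ)
    (hfs_pos : ∀ᵐ x ∂μ, 0 < (fstar : X → ℝ) x)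
    (hfs_one : ∫ x, (fstar : X → ℝ) x ∂μ = 1)
    (hstat : ∀ t, 0 ≤ t → P t fstar = fstar)
    (hstable : ∀ f₀ : Lp ℝ 1 μ, 0 ≤ f₀ → ∫ x, (f₀ : X → ℝ) x ∂μ = 1 →
      Tendsto (fun t => ‖P t f₀ - fstar‖) atTop (nhds 0))
    (hmoment : ∃ ε > (0:ℝ), ∀ r : ℝ, |r| < ε →
      (∫⁻ x, ENNReal.ofReal (((fstar : X → ℝ) x) ^ ((1 : ℝ) + r)) ∂μ) < ⊤)
    (f₀ : Lp ℝ 1 μ) (hf₀_pos : 0 ≤ f₀) (hf₀_one : ∫ x, (f₀ : X → ℝ) x ∂μ = 1)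
    (hfin : ⊥ < condEnt μ (f₀ : X → ℝ) (fstar : X → ℝ)) :
    Tendsto (fun t => gibbsEnt μ (P t f₀ : X → ℝ)) atTop
      (nhds (gibbsEnt μ (fstar : X → ℝ))) := by
  obtain ⟨ε, hε, hmom⟩ := hmoment
  set r := ε / 2 with hr
  have hr0 : 0 < r := by positivity
  have f0nn := (Lp.coeFn_nonneg f₀).2 hf₀_pos
  have hu_nn : 0 ≤ fstar := (Lp.coeFn_nonneg _).1 (hfs_pos.mono fun x hx => hx.le)
  have hmint : ∀ s : ℝ, |s| < ε → Integrable (fun x => (fstar : X → ℝ) x ^ (1 + s)) μ := by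
    intro s hs
    have hm : AEStronglyMeasurable (fun x => (fstar : X → ℝ) x ^ (1 + s)) μ :=
      ((Lp.aestronglyMeasurable fstar).aemeasurable.pow_const _).aestronglyMeasurable
    refine ⟨hm, ?_⟩
    rw [hasFiniteIntegral_iff_ofReal]
    · exact hmom s hs
    · filter_upwards [hfs_pos] with x hx
      exact (Real.rpow_pos_of_pos hx _).le
  have hm1 := hmint r (by rw [abs_of_pos hr0]; linarith)
  have hm2 := hmint (-r) (by rw [abs_neg, abs_of_pos hr0]; linarith)
  let φ₀ : X → ℝ := fun x => (f₀ : X → ℝ) x * Real.log ((f₀ : X → ℝ) x / (fstar : X → ℝ) x)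
    + (fstar : X → ℝ) x - (f₀ : X → ℝ) x
  have mf := (Lp.aestronglyMeasurable f₀).aemeasurable
  have mu := (Lp.aestronglyMeasurable fstar).aemeasurable
  have hφnn : ∀ᵐ x ∂μ, 0 ≤ φ₀ x := by
    filter_upwards [f0nn, hfs_pos] with x h1 h2
    have := aux_tangent _ _ 1 h1 h2 one_pos
    rw [Real.log_one] at this
    simp only [φ₀]
    linarith
  have hφi : Integrable φ₀ μ := by
    refine ⟨(((mf.mul (mf.div mu).log).add mu).sub mf).aestronglyMeasurable, ?_⟩
    rw [hasFiniteIntegral_iff_ofReal hφnn]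
    rw [lt_top_iff_ne_top]
    intro h
    apply hfin.ne'
    unfold condEnt
    rw [show (∫⁻ x, ENNReal.ofReal ((f₀ : X → ℝ) x * Real.log ((f₀ : X → ℝ) x / (fstar : X → ℝ) x)
      + (fstar : X → ℝ) x - (f₀ : X → ℝ) x) ∂μ) = ⊤ from h]
    simp
  let φ : Lp ℝ 1 μ := hφi.toL1
  have hφ : ∀ᵐ x ∂μ, (φ : X → ℝ) x = φ₀ x := hφi.coeFn_toL1
  have hφ0 : 0 ≤ φ := by
    rw [← Lp.coeFn_nonneg]
    filter_upwards [hφ, hφnn] with x h1 h2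
    rw [h1]; exact h2
  have S1 := hstable f₀ hf₀_pos hf₀_one
  have S2 := aux_stable P fstar hstable φ hφ0
  unfold gibbsEnt
  refine Tendsto.neg ?_
  refine tendsto_of_subseq_tendsto fun t ht => ?_
  obtain ⟨M, hM⟩ := eventually_atTop.1 (ht.eventually (eventually_ge_atTop (0 : ℝ)))
  have ht' : Tendsto (fun n => t (n + M)) atTop atTop := ht.comp (tendsto_add_atTop_nat M)
  obtain ⟨ns, hns, hae⟩ := aux_ae (fun n => P (t (n + M)) f₀) fstar (S1.comp ht')
  refine ⟨fun n => ns n + M, ?_⟩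
  let τ : ℕ → ℝ := fun n => t (ns n + M)
  have hτ : Tendsto τ atTop atTop := ht'.comp hns.tendsto_atTop
  have hτ0 : ∀ n, 0 ≤ τ n := fun n => hM _ (by simp)
  let w : X → ℝ := fun x => (fstar : X → ℝ) x ^ (1 + r) + (fstar : X → ℝ) x ^ (1 + -r)
  have hw : Integrable w μ := hm1.add hm2
  let L : Lp ℝ 1 μ := ‖φ‖ • fstar
  have iu := L1.integrable_coeFn fstar
  have hLx : ∀ᵐ x ∂μ, 0 ≤ (L : X → ℝ) x :=
    (Lp.coeFn_nonneg L).2 (aux_smul _ (norm_nonneg _) _ hu_nn)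
  refine aux_pratt (fun n x => (P (τ n) f₀ : X → ℝ) x * Real.log ((P (τ n) f₀ : X → ℝ) x))
    (fun n x => (1 + 1 / r) * (P (τ n) φ : X → ℝ) x + (P (τ n) f₀ : X → ℝ) x
      + (fstar : X → ℝ) x + (1 / r) * w x) _
    (fun x => (1 + 1 / r) * (L : X → ℝ) x + (fstar : X → ℝ) x
      + (fstar : X → ℝ) x + (1 / r) * w x) ?_ ?_ ?_ ?_ ?_ ?_ ?_
  · intro n
    have m := (Lp.aestronglyMeasurable (P (τ n) f₀)).aemeasurable
    exact (m.mul m.log).aestronglyMeasurable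
  · intro n
    exact ((((L1.integrable_coeFn _).const_mul _).add (L1.integrable_coeFn _)).add iu).add
      (hw.const_mul _)
  · exact ((((L1.integrable_coeFn _).const_mul _).add iu).add iu).add (hw.const_mul _)
  · intro n
    have hd := aux_dom (P (τ n)) (hP_pos _ (hτ0 n)) fstar f₀ φ hfs_pos (hstat _ (hτ0 n)) hf₀_pos hφ
    filter_upwards [hd, hfs_pos, (Lp.coeFn_nonneg _).2 (hP_pos _ (hτ0 n) f₀ hf₀_pos)] with x h1 h2 h3
    have h4 := aux_young _ _ r h3 h2 hr0
    refine h4.trans ?_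
    have h5 : 0 ≤ 1 + 1 / r := by positivity
    have := mul_le_mul_of_nonneg_left h1 h5
    simp only [w]
    linarith
  · filter_upwards [hfs_pos, hLx] with x h2 h3
    have h4 := aux_young _ _ r h2.le h2 hr0
    refine h4.trans ?_
    have h5 : 0 ≤ 1 + 1 / r := by positivity
    have := mul_nonneg h5 h3
    rw [div_self h2.ne', Real.log_one]
    simp only [w]
    linarith
  · filter_upwards [hae] with x hx
    exact (Real.continuous_mul_log.tendsto _).comp hx
  · have T1 := (S2.comp hτ).const_mul (1 + 1 / r)
    have T := T1.add (S1.comp hτ)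
    rw [mul_zero, add_zero] at T
    refine squeeze_zero (fun n => integral_nonneg fun x => abs_nonneg _) (fun n => ?_) T
    have I1 : Integrable (fun x => |(P (τ n) φ : X → ℝ) x - (L : X → ℝ) x|) μ :=
      ((L1.integrable_coeFn _).sub (L1.integrable_coeFn _)).abs
    have I2 : Integrable (fun x => |(P (τ n) f₀ : X → ℝ) x - (fstar : X → ℝ) x|) μ :=
      ((L1.integrable_coeFn _).sub (L1.integrable_coeFn _)).abs
    simp only [Function.comp]
    rw [aux_norm, aux_norm, ← integral_const_mul, ← integral_add (I1.const_mul _) I2]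
    refine integral_mono_of_nonneg (Eventually.of_forall fun x => abs_nonneg _)
      ((I1.const_mul _).add I2) (Eventually.of_forall fun x => ?_)
    have h5 : 0 ≤ 1 + 1 / r := by positivity
    simp only []
    rw [← abs_of_nonneg h5, ← abs_mul, abs_of_nonneg h5]
    refine le_trans (le_of_eq ?_) (abs_add_le _ _)
    congr 1
    ring
end
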